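/- Every Gδ subset X of the Cantor space can be written as a union of countably many pairwise disjoint sets, each closed in X, such that each of them (with the subspace topology) is homeomorphic to a one-point space, or to the Cantor space, or to the space of irrational numbers. -/

import Mathlib

open Set Filter Topology TopologicalSpace PiNat

namespace GdeltaPieces

/-- Cells of the scheme generated by a splitting function. -/
def cell {Y α : Type*} (g : Set Y → ℕ → Y → α) : List α → Set Y
  | [] => univ
  | a :: l => cell g l ∩ g (cell g l) l.length ⁻¹' {a}

section scheme
variable {Y α : Type*} [TopologicalSpace Y] [TopologicalSpace α] [DiscreteTopology α]
  (g : Set Y → ℕ → Y → α)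

theorem cell_clopen [Nonempty Y]
    (hg : ∀ C n, IsClopen C → C.Nonempty → ContinuousOn (g C n) C ∧ ∀ a, ∃ x ∈ C, g C n x = a)
    (l : List α) : IsClopen (cell g l) ∧ (cell g l).Nonempty := by
  induction l with
  | nil => exact ⟨isClopen_univ, univ_nonempty⟩
  | cons a l ih =>
    obtain ⟨hc, hs⟩ := hg (cell g l) l.length ih.1 ih.2
    refine ⟨⟨hc.preimage_isClosed_of_isClosed ih.1.1 (isClosed_discrete _),
      hc.isOpen_inter_preimage ih.1.2 (isOpen_discrete _)⟩, ?_⟩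
    obtain ⟨x, hx, hxa⟩ := hs a
    exact ⟨x, hx, hxa⟩

theorem exists_code (x : Y) : ∃ f : ℕ → α, ∀ n, x ∈ cell g (res f n) := by
  let L : ℕ → List α := fun n => Nat.rec [] (fun _ l => g (cell g l) l.length x :: l) n
  let f : ℕ → α := fun n => g (cell g (L n)) (L n).length x
  have hL : ∀ n, res f n = L n := by
    intro n
    induction n with
    | zero => rfl
    | succ n ih => rw [res_succ, ih]
  refine ⟨f, fun n => ?_⟩
  induction n with
  | zero => trivial
  | succ n ih =>
    rw [res_succ]
    refine ⟨ih, ?_⟩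
    rw [hL]; rfl

theorem code_unique {x : Y} {f f' : ℕ → α} {n : ℕ} (h : x ∈ cell g (res f n))
    (h' : x ∈ cell g (res f' n)) : res f n = res f' n := by
  induction n with
  | zero => rfl
  | succ n ih =>
    rw [res_succ] at *
    rw [res_succ]
    have e := ih h.1 h'.1
    have h1 : g (cell g (res f n)) (res f n).length x = f n := h.2
    have h2 : g (cell g (res f' n)) (res f' n).length x = f' n := h'.2
    rw [← e] at h2 ⊢
    rw [← h1, ← h2]

theorem homeo_of_split [Nonempty Y] [T1Space Y]
    (hg : ∀ C n, IsClopen C → C.Nonempty → ContinuousOn (g C n) C ∧ ∀ a, ∃ x ∈ C, g C n x = a)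
    (hne : ∀ f : ℕ → α, ∃ x, ∀ n, x ∈ cell g (res f n))
    (hsm : ∀ (f : ℕ → α) (x : Y), (∀ n, x ∈ cell g (res f n)) → ∀ U ∈ 𝓝 x,
      ∃ n, cell g (res f n) ⊆ U) : Nonempty (Y ≃ₜ (ℕ → α)) := by
  choose F hF using hne
  choose c hc using exists_code g
  have hcF : ∀ f, c (F f) = f := by
    intro f
    apply res_injective
    funext n
    exact code_unique g (hc (F f) n) (hF f n)
  have hFc : ∀ x, F (c x) = x := by
    intro x
    by_contra hne
    obtain ⟨n, hn⟩ := hsm (c x) x (hc x) {F (c x)}ᶜ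
      (isOpen_compl_singleton.mem_nhds (by simpa using Ne.symm hne))
    exact hn (hF (c x) n) rfl
  refine ⟨⟨⟨c, F, hFc, hcF⟩, ?_, ?_⟩⟩
  · refine continuous_pi fun n => ?_
    refine continuous_iff_continuousAt.2 fun x => ?_
    refine (continuousAt_const (y := c x n)).congr ?_
    filter_upwards [(cell_clopen g hg (res (c x) (n+1))).1.2.mem_nhds (hc x (n+1))] with y hy
    exact res_eq_res.1 (code_unique g hy (hc y (n+1))) (Nat.lt_succ_self n)
  · refine continuous_iff_continuousAt.2 fun f => ?_
    intro U hU
    obtain ⟨n, hn⟩ := hsm f (F f) (hF f) U hU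
    have : {f' : ℕ → α | ∀ m ∈ Finset.range n, f' m = f m} ∈ 𝓝 f := by
      rw [show {f' : ℕ → α | ∀ m ∈ Finset.range n, f' m = f m} =
        ⋂ m ∈ Finset.range n, {f' | f' m = f m} by ext; simp]
      refine (Filter.biInter_finset_mem _).2 fun m _ => ?_
      exact (continuous_apply m).continuousAt.preimage_mem_nhds
        ((isOpen_discrete {f m}).mem_nhds rfl)
    refine Filter.mem_map.2 (mem_of_superset this fun f' hf' => ?_)
    change F f' ∈ U
    apply hn
    rw [← (res_eq_res (x := f') (y := f)).2 fun m hm => hf' m (Finset.mem_range.2 hm)]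
    exact hF f' n
end scheme

theorem cell_succ_subset {Y α : Type*} (g : Set Y → ℕ → Y → α) (f : ℕ → α) (n : ℕ) :
    cell g (res f (n+1)) ⊆ cell g (res f n) := fun _ hx => hx.1

theorem cantor_of_perfect (P : Set (ℕ → Bool)) (hP : Perfect P) (hne : P.Nonempty) :
    Nonempty (P ≃ₜ (ℕ → Bool)) := by
  classical
  have : Nonempty P := hne.to_subtype
  have : CompactSpace P := isCompact_iff_compactSpace.1 hP.closed.isCompact
  let g : Set P → ℕ → P → Bool := fun C _ x =>
    x.1 (sInf {n | ∃ y ∈ C, ∃ z ∈ C, y.1 n ≠ z.1 n})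
  have key : ∀ C : Set P, IsClopen C → C.Nonempty → 
      ∃ n, ∃ y ∈ C, ∃ z ∈ C, y.1 n ≠ z.1 n := by
    rintro C hC ⟨x, hx⟩
    obtain ⟨O, hO, rfl⟩ := isOpen_induced_iff.1 hC.2
    obtain ⟨y, hy, hyx⟩ := preperfect_iff_nhds.1 hP.acc x.1 x.2 O (hO.mem_nhds hx)
    obtain ⟨n, hn⟩ := Function.ne_iff.1 hyx
    exact ⟨n, ⟨y, hy.2⟩, hy.1, x, hx, hn⟩
  have hg : ∀ C n, IsClopen C → C.Nonempty →
      ContinuousOn (g C n) C ∧ ∀ a, ∃ x ∈ C, g C n x = a := by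
    intro C n hC hCn
    refine ⟨((continuous_apply _).comp continuous_subtype_val).continuousOn, fun a => ?_⟩
    obtain ⟨y, hy, z, hz, hyz⟩ := Nat.sInf_mem (key C hC hCn)
    by_cases h : g C n y = a
    · exact ⟨y, hy, h⟩
    · refine ⟨z, hz, ?_⟩
      change z.1 _ = a
      change ¬ y.1 _ = a at h
      exact (by decide : ∀ b c d : Bool, b ≠ c → ¬ b = d → c = d) _ _ _ hyz h
  have agree : ∀ (f : ℕ → Bool) (n : ℕ), ∀ y ∈ cell g (res f n), ∀ z ∈ cell g (res f n),
      ∀ m < n, y.1 m = z.1 m := by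
    intro f n
    induction n with
    | zero => intro y _ z _ m hm; omega
    | succ n ih =>
      intro y hy z hz m hm
      have hcl := cell_clopen g hg (res f n)
      obtain ⟨p, hp, q, hq, hpq⟩ := Nat.sInf_mem (key _ hcl.1 hcl.2)
      set N := sInf {k | ∃ y ∈ cell g (res f n), ∃ z ∈ cell g (res f n), y.1 k ≠ z.1 k} with hN
      have hnN : n ≤ N := by
        by_contra hlt
        exact hpq (ih p hp q hq N (by omega))
      have hy2 : y.1 N = f n := hy.2
      have hz2 : z.1 N = f n := hz.2
      rcases (show m < N ∨ m = N by omega) with h | h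
      · by_contra hne
        exact Nat.notMem_of_lt_sInf h ⟨y, hy.1, z, hz.1, hne⟩
      · rw [h, hy2, hz2]
  refine homeo_of_split g hg (fun f => ?_) (fun f x hx U hU => ?_)
  · have := IsCompact.nonempty_iInter_of_sequence_nonempty_isCompact_isClosed
      (fun n => cell g (res f n)) (cell_succ_subset g f) (fun n => (cell_clopen g hg _).2)
      isCompact_univ (fun n => (cell_clopen g hg _).1.1)
    obtain ⟨x, hx⟩ := this
    exact ⟨x, fun n => mem_iInter.1 hx n⟩
  · obtain ⟨O, hO, hOU⟩ := mem_nhds_subtype _ _ _ |>.1 hU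
    obtain ⟨I, t, ht, hIt⟩ : ∃ (I : Finset ℕ) (t : ℕ → Set Bool), (∀ i, t i ∈ 𝓝 (x.1 i)) ∧ 
        (I : Set ℕ).pi t ⊆ O := by
      rw [nhds_pi, Filter.mem_pi] at hO
      obtain ⟨I, hI, t, ht, h⟩ := hO
      exact ⟨hI.toFinset, t, ht, by simpa using h⟩
    refine ⟨I.sup id + 1, fun y hy => hOU (hIt fun i hi => ?_)⟩
    have : i ≤ I.sup id := Finset.le_sup (f := id) hi
    rw [agree f _ y hy x (hx _) i (by omega)]
    exact mem_of_mem_nhds (ht i)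

theorem split_exists {Y : Type*} [MetricSpace Y] [SecondCountableTopology Y]
    (hB : ∀ (x : Y), ∀ U ∈ 𝓝 x, ∃ V, IsClopen V ∧ x ∈ V ∧ V ⊆ U)
    (C : Set Y) (hC : IsClopen C) (hCne : C.Nonempty) (hnc : ¬ IsCompact C) (ε : ℝ) (hε : 0 < ε) :
    ∃ g : Y → ℕ, ContinuousOn g C ∧ (∀ a, ∃ x ∈ C, g x = a) ∧
      ∀ x ∈ C, ∀ y ∈ C, g x = g y → dist x y < ε := by
  classical
  rw [isCompact_iff_finite_subcover] at hnc
  push Not at hnc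
  obtain ⟨ι, U, hUo, hUC, hUf⟩ := hnc
  let S : Set (Set Y) := {V | IsClopen V ∧ (∀ x ∈ V, ∀ y ∈ V, dist x y < ε) ∧ ∃ i, V ⊆ U i}
  obtain ⟨T, hT, hTS, hTU⟩ := isOpen_sUnion_countable S (fun V hV => hV.1.2)
  have hcov : C ⊆ ⋃₀ T := by
    rw [hTU]
    intro x hx
    obtain ⟨i, hi⟩ := mem_iUnion.1 (hUC hx)
    obtain ⟨V, hV, hxV, hVU⟩ := hB x (U i ∩ Metric.ball x (ε/2))
      (inter_mem ((hUo i).mem_nhds hi) (Metric.ball_mem_nhds x (by positivity)))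
    refine ⟨V, ⟨hV, fun y hy z hz => ?_, i, fun y hy => (hVU hy).1⟩, hxV⟩
    have h1 := (hVU hy).2
    have h2 := (hVU hz).2
    rw [Metric.mem_ball] at h1 h2
    have := dist_triangle_right y z x
    linarith
  have hTne : T.Nonempty := by
    obtain ⟨x, hx⟩ := hCne
    obtain ⟨V, hV, -⟩ := hcov hx
    exact ⟨V, hV⟩
  obtain ⟨v, rfl⟩ := hT.exists_eq_range hTne
  have hv : ∀ n, v n ∈ S := fun n => hTS ⟨n, rfl⟩
  have hex : ∀ x ∈ C, ∃ n, x ∈ v n := by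
    intro x hx
    obtain ⟨_, ⟨n, rfl⟩, h⟩ := hcov hx
    exact ⟨n, h⟩
  let N : Y → ℕ := fun x => sInf {n | x ∈ v n}
  have hN : ∀ x ∈ C, x ∈ v (N x) := fun x hx => Nat.sInf_mem (hex x hx)
  have hNc : ∀ x ∈ C, ∀ᶠ y in 𝓝 x, N y = N x := by
    intro x hx
    have h1 : v (N x) ∈ 𝓝 x := (hv _).1.2.mem_nhds (hN x hx)
    have h2 : (⋂ m ∈ Finset.range (N x), (v m)ᶜ) ∈ 𝓝 x := by
      refine (Filter.biInter_finset_mem _).2 fun m hm => ?_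
      exact (hv m).1.1.isOpen_compl.mem_nhds (Nat.notMem_of_lt_sInf (Finset.mem_range.1 hm))
    filter_upwards [h1, h2] with y hy1 hy2
    apply le_antisymm (Nat.sInf_le hy1)
    by_contra hlt
    push Not at hlt
    have : y ∈ v (N y) := Nat.sInf_mem (s := {n | y ∈ v n}) ⟨_, hy1⟩
    simp only [mem_iInter] at hy2
    exact hy2 (N y) (Finset.mem_range.2 hlt) this
  let R : ℕ → Prop := fun n => ∃ x ∈ C, N x = n
  have hR : (setOf R).Infinite := by
    intro hfin
    choose i hi using fun n => (hv n).2.2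
    apply hUf (hfin.toFinset.image i)
    intro x hx
    simp only [mem_iUnion]
    refine ⟨i (N x), Finset.mem_image_of_mem _ ?_, hi _ (hN x hx)⟩
    exact hfin.mem_toFinset.2 ⟨x, hx, rfl⟩
  refine ⟨fun x => Nat.count R (N x), ?_, ?_, ?_⟩
  · intro x hx
    refine ContinuousAt.continuousWithinAt ?_
    refine (continuousAt_const (y := Nat.count R (N x))).congr ?_
    filter_upwards [hNc x hx] with y hy
    rw [hy]
  · intro a
    obtain ⟨x, hx, hxa⟩ := Nat.nth_mem_of_infinite hR a
    exact ⟨x, hx, by simp only [hxa]; exact Nat.count_nth_of_infinite hR a⟩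
  · intro x hx y hy hxy
    have : N x = N y := Nat.count_injective ⟨x, hx, rfl⟩ ⟨y, hy, rfl⟩ hxy
    exact (hv (N x)).2.1 x (hN x hx) y (this ▸ hN y hy)

theorem baire_of_nlc {Y : Type*} [TopologicalSpace Y] [PolishSpace Y] [Nonempty Y]
    (hB : ∀ (x : Y), ∀ U ∈ 𝓝 x, ∃ V, IsClopen V ∧ x ∈ V ∧ V ⊆ U)
    (hnc : ∀ C : Set Y, IsClopen C → C.Nonempty → ¬ IsCompact C) :
    Nonempty (Y ≃ₜ (ℕ → ℕ)) := by
  classical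
  letI := upgradeIsCompletelyMetrizable Y
  have hsp : ∀ (C : Set Y) (n : ℕ), ∃ g : Y → ℕ, IsClopen C → C.Nonempty →
      ContinuousOn g C ∧ (∀ a, ∃ x ∈ C, g x = a) ∧
      ∀ x ∈ C, ∀ y ∈ C, g x = g y → dist x y < 1 / ((n:ℝ) + 1) := by
    intro C n
    by_cases h : IsClopen C ∧ C.Nonempty
    · obtain ⟨g, hg⟩ := split_exists hB C h.1 h.2 (hnc C h.1 h.2) (1 / ((n:ℝ) + 1)) (by positivity)
      exact ⟨g, fun _ _ => hg⟩
    · exact ⟨fun _ => 0, fun h1 h2 => absurd ⟨h1, h2⟩ h⟩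
  choose g hg using hsp
  have hg' : ∀ C n, IsClopen C → C.Nonempty →
      ContinuousOn (g C n) C ∧ ∀ a, ∃ x ∈ C, g C n x = a :=
    fun C n h1 h2 => ⟨(hg C n h1 h2).1, (hg C n h1 h2).2.1⟩
  have hd : ∀ f n, ∀ x ∈ cell g (res f (n+1)), ∀ y ∈ cell g (res f (n+1)),
      dist x y < 1 / ((n:ℝ) + 1) := by
    intro f n x hx y hy
    have hc := cell_clopen g hg' (res f n)
    have := (hg _ (res f n).length hc.1 hc.2).2.2 x hx.1 y hy.1 (by
      have h1 : g _ _ x = f n := hx.2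
      have h2 : g _ _ y = f n := hy.2
      rw [h1, h2])
    rwa [res_length] at this
  refine homeo_of_split g hg' (fun f => ?_) (fun f x hx U hU => ?_)
  · choose u hu using fun n => (cell_clopen g hg' (res f (n+1))).2
    have hanti : Antitone (fun n => cell g (res f n)) :=
      antitone_nat_of_succ_le (cell_succ_subset g f)
    have hcau : CauchySeq u := by
      refine cauchySeq_of_le_tendsto_0' (fun n : ℕ => 1 / ((n:ℝ) + 1)) (fun n m hnm => ?_)
        tendsto_one_div_add_atTop_nhds_zero_nat
      exact (hd f n _ (hu n) _ (hanti (by omega : n + 1 ≤ m + 1) (hu m))).le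
    obtain ⟨x, hx⟩ := cauchySeq_tendsto_of_complete hcau
    refine ⟨x, fun n => ?_⟩
    refine (cell_clopen g hg' (res f n)).1.1.mem_of_tendsto hx ?_
    filter_upwards [eventually_ge_atTop n] with m hm
    exact hanti (by omega : n ≤ m + 1) (hu m)
  · obtain ⟨ε, hε, hεU⟩ := Metric.mem_nhds_iff.1 hU
    obtain ⟨n, hn⟩ := exists_nat_one_div_lt hε
    exact ⟨n+1, fun y hy => hεU ((hd f n y hy x (hx _)).trans hn)⟩

theorem gdelta_polish {Z : Type*} [TopologicalSpace Z] [PolishSpace Z] (s : Set Z) (hs : IsGδ s) :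
    PolishSpace s := by
  obtain ⟨U, hU, rfl⟩ := isGδ_iff_eq_iInter_nat.1 hs
  have : ∀ n, PolishSpace (U n) := fun n => (hU n).polishSpace
  have : PolishSpace (∀ n, U n) := {}
  let F : (⋂ n, U n : Set Z) → ∀ n, U n := fun x n => ⟨x.1, mem_iInter.1 x.2 n⟩
  have hF : Continuous F := by fun_prop
  have hemb : IsEmbedding F := by
    refine IsEmbedding.of_comp hF ((continuous_subtype_val).comp (continuous_apply 0)) ?_
    exact IsEmbedding.subtypeVal
  refine IsClosedEmbedding.polishSpace (f := F) ⟨hemb, ?_⟩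
  have : range F = ⋂ n, {f : ∀ n, U n | (f n).1 = (f 0).1} := by
    ext f
    simp only [mem_range, mem_iInter, mem_setOf_eq]
    constructor
    · rintro ⟨x, rfl⟩ n; rfl
    · intro h
      refine ⟨⟨(f 0).1, mem_iInter.2 fun n => h n ▸ (f n).2⟩, ?_⟩
      funext n
      exact Subtype.ext (h n).symm
  rw [this]
  exact isClosed_iInter fun n => isClosed_eq (by fun_prop) (by fun_prop)

theorem irrational_baire : Nonempty ({x : ℝ // Irrational x} ≃ₜ (ℕ → ℕ)) := by
  have : PolishSpace {x : ℝ // Irrational x} := gdelta_polish _ IsGδ.setOfPred_irrational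
  have : Nonempty {x : ℝ // Irrational x} := ⟨⟨_, irrational_sqrt_two⟩⟩
  apply baire_of_nlc
  · intro x U hU
    obtain ⟨O, hO, hOU⟩ := mem_nhds_subtype _ _ _ |>.1 hU
    obtain ⟨ε, hε, hεO⟩ := Metric.mem_nhds_iff.1 hO
    rw [Real.ball_eq_Ioo] at hεO
    obtain ⟨p, hp1, hp2⟩ := exists_rat_btwn (show x.1 - ε < x.1 by linarith)
    obtain ⟨q, hq1, hq2⟩ := exists_rat_btwn (show x.1 < x.1 + ε by linarith)
    refine ⟨Subtype.val ⁻¹' Ioo (p:ℝ) q, ⟨?_, isOpen_Ioo.preimage continuous_subtype_val⟩,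
      ⟨hp2, hq1⟩, fun y hy => hOU (hεO ⟨hp1.trans hy.1, hy.2.trans hq2⟩)⟩
    have : (Subtype.val ⁻¹' Ioo (p:ℝ) q : Set {x : ℝ // Irrational x}) =
        Subtype.val ⁻¹' Icc (p:ℝ) q := by
      ext y
      have h1 := y.2.ne_rat p
      have h2 := y.2.ne_rat q
      constructor
      · exact fun h => ⟨h.1.le, h.2.le⟩
      · exact fun h => ⟨lt_of_le_of_ne h.1 (Ne.symm h1), lt_of_le_of_ne h.2 h2⟩
    rw [this]
    exact isClosed_Icc.preimage continuous_subtype_val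
  · rintro C hC ⟨x, hx⟩ hcomp
    have hcl : IsClosed (Subtype.val '' C : Set ℝ) := (hcomp.image continuous_subtype_val).isClosed
    obtain ⟨O, hO, rfl⟩ := isOpen_induced_iff.1 hC.2
    obtain ⟨q, hq⟩ := Rat.denseRange_cast.exists_mem_open hO ⟨x.1, hx⟩
    have hmem : (q:ℝ) ∈ closure (O ∩ {x | Irrational x}) :=
      dense_irrational.open_subset_closure_inter hO hq
    have hsub : O ∩ {x | Irrational x} ⊆ Subtype.val '' (Subtype.val ⁻¹' O : Set {x : ℝ // Irrational x}) :=
      fun y hy => ⟨⟨y, hy.2⟩, hy.1, rfl⟩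
    obtain ⟨y, -, hy⟩ := hcl.closure_subset_iff.2 hsub hmem
    exact y.2 ⟨q, hy.symm⟩

/-- Countable disjoint unions of compact pieces that are points or Cantor sets. -/
def Good (A : Set (ℕ → Bool)) : Prop :=
  ∃ S : Set (Set (ℕ → Bool)), S.Countable ∧ S.Pairwise Disjoint ∧ ⋃₀ S = A ∧
    ∀ B ∈ S, IsCompact B ∧ (Nonempty (B ≃ₜ Unit) ∨ Nonempty (B ≃ₜ (ℕ → Bool)))

theorem Good.iUnion {ι : Type*} [Countable ι] (A : ι → Set (ℕ → Bool)) (hA : ∀ i, Good (A i))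
    (hd : Pairwise (fun i j => Disjoint (A i) (A j))) : Good (⋃ i, A i) := by
  choose S hS hp hU hc using hA
  refine ⟨⋃ i, S i, countable_iUnion hS, ?_, ?_, ?_⟩
  · intro s hs t ht hst
    obtain ⟨i, hi⟩ := mem_iUnion.1 hs
    obtain ⟨j, hj⟩ := mem_iUnion.1 ht
    by_cases hij : i = j
    · subst hij
      exact hp i hi hj hst
    · exact (hd hij).mono (hU i ▸ subset_sUnion_of_mem hi) (hU j ▸ subset_sUnion_of_mem hj)
  · rw [sUnion_iUnion]
    exact iUnion_congr hU
  · intro B hB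
    obtain ⟨i, hi⟩ := mem_iUnion.1 hB
    exact hc i B hi

theorem good_compact (K : Set (ℕ → Bool)) (hK : IsCompact K) : Good K := by
  obtain ⟨V, P, hV, hP, rfl⟩ := exists_countable_union_perfect_of_isClosed hK.isClosed
  refine ⟨(fun v => {v}) '' (V \ P) ∪ {Q | Q = P ∧ P.Nonempty}, ?_, ?_, ?_, ?_⟩
  · exact ((hV.mono diff_subset).image _).union ((countable_singleton P).mono fun Q hQ => hQ.1)
  · rintro s (⟨v, hv, rfl⟩ | ⟨rfl, -⟩) t (⟨w, hw, rfl⟩ | ⟨rfl, -⟩) hst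
    · simp only [disjoint_singleton]
      rintro rfl
      exact hst rfl
    · exact disjoint_singleton_left.2 hv.2
    · exact disjoint_singleton_right.2 hw.2
    · exact absurd rfl hst
  · ext x
    constructor
    · rintro ⟨s, (⟨v, hv, rfl⟩ | ⟨rfl, -⟩), hx⟩
      · rw [mem_singleton_iff.1 hx]; exact Or.inl hv.1
      · exact Or.inr hx
    · intro hx
      by_cases hxP : x ∈ P
      · exact ⟨P, Or.inr ⟨rfl, x, hxP⟩, hxP⟩
      · exact ⟨{x}, Or.inl ⟨x, ⟨hx.resolve_right hxP, hxP⟩, rfl⟩, rfl⟩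
  · rintro s (⟨v, hv, rfl⟩ | ⟨rfl, hne⟩)
    · exact ⟨isCompact_singleton, Or.inl ⟨Homeomorph.homeomorphOfUnique _ _⟩⟩
    · exact ⟨hP.closed.isCompact, Or.inr (cantor_of_perfect _ hP hne)⟩

theorem good_open_inter (K O : Set (ℕ → Bool)) (hK : IsCompact K) (hO : IsOpen O) :
    Good (K ∩ O) := by
  obtain ⟨T, hT, hTS, hTU⟩ := isOpen_sUnion_countable {W | IsClopen W ∧ W ⊆ O}
    (fun W hW => hW.1.2)
  have hOT : O = ⋃₀ (insert ∅ T) := by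
    rw [sUnion_insert, empty_union, hTU]
    apply subset_antisymm
    · intro x hx
      obtain ⟨V, hV, hxV, hVO⟩ := compact_exists_isClopen_in_isOpen hO hx
      exact ⟨V, ⟨hV, hVO⟩, hxV⟩
    · exact sUnion_subset fun W hW => hW.2
  obtain ⟨v, hv⟩ := (hT.insert ∅).exists_eq_range (insert_nonempty _ _)
  have hvc : ∀ n, IsClopen (v n) := by
    intro n
    have : v n ∈ insert ∅ T := hv ▸ mem_range_self n
    rcases this with h | h
    · rw [h]; exact isClopen_empty
    · exact (hTS h).1
  have : K ∩ O = ⋃ n, K ∩ disjointed v n := by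
    rw [← inter_iUnion, iUnion_disjointed, hOT, hv, sUnion_range]
  rw [this]
  refine Good.iUnion _ (fun n => good_compact _ (hK.inter_right ?_)) ?_
  · exact (disjointedRec (p := IsClopen) (fun t i h => h.diff (hvc i)) (hvc n)).1
  · intro i j hij
    exact (disjoint_disjointed v hij).mono inter_subset_right inter_subset_right

theorem good_sigma (A : Set (ℕ → Bool)) (hA : IsSigmaCompact A) : Good A := by
  obtain ⟨K, hK, rfl⟩ := hA
  rw [← iUnion_disjointed]
  refine Good.iUnion _ (fun n => ?_) (disjoint_disjointed K)
  have : disjointed K n = K n ∩ (⋃ m ∈ Finset.range n, K m)ᶜ := by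
    rw [disjointed_eq_inter_compl]
    ext x; simp
  rw [this]
  refine good_open_inter _ _ (hK n) ?_
  exact ((Finset.range n).isCompact_biUnion fun m _ => hK m).isClosed.isOpen_compl

theorem sigma_inter {Z : Type*} [TopologicalSpace Z] (A F : Set Z) (hA : IsSigmaCompact A)
    (hF : IsClosed F) : IsSigmaCompact (A ∩ F) := by
  obtain ⟨K, hK, rfl⟩ := hA
  rw [iUnion_inter]
  exact isSigmaCompact_iUnion_of_isCompact _ fun n => (hK n).inter_right hF

theorem cantor_polish : PolishSpace (ℕ → Bool) := by
  let := TopologicalSpace.metrizableSpaceMetric (ℕ → Bool)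
  infer_instance

end GdeltaPieces
open GdeltaPieces in
theorem gdelta_partition_into_canonical_pieces (X : Set (ℕ → Bool))
    (hX : IsGδ X) :
    ∃ S : Set (Set (ℕ → Bool)),
      S.Countable ∧
      (∀ A ∈ S, A ⊆ X) ∧
      S.Pairwise Disjoint ∧
      ⋃₀ S = X ∧
      (∀ A ∈ S, IsClosed (Subtype.val ⁻¹' A : Set ↥X)) ∧
      (∀ A ∈ S,
        Nonempty (↥A ≃ₜ Unit) ∨
        Nonempty (↥A ≃ₜ (ℕ → Bool)) ∨
        Nonempty (↥A ≃ₜ {x : ℝ // Irrational x})) := by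
  obtain ⟨T, hT, hTS, hTU⟩ := isOpen_sUnion_countable
    {W : Set (ℕ → Bool) | IsClopen W ∧ IsSigmaCompact (X ∩ W)} (fun W hW => hW.1.2)
  set G := ⋃₀ {W : Set (ℕ → Bool) | IsClopen W ∧ IsSigmaCompact (X ∩ W)} with hG
  have hGo : IsOpen G := isOpen_sUnion fun W hW => hW.1.2
  have hXG : IsSigmaCompact (X ∩ G) := by
    rw [← hTU, sUnion_eq_biUnion, inter_iUnion₂]
    exact isSigmaCompact_biUnion hT fun W hW => (hTS hW).2
  obtain ⟨S, hS, hSp, hSU, hSc⟩ := good_sigma _ hXG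
  have hSub : ∀ A ∈ S, A ⊆ X ∩ G := fun A hA => hSU ▸ subset_sUnion_of_mem hA
  have hY : (X \ G).Nonempty → Nonempty (↥(X \ G) ≃ₜ {x : ℝ // Irrational x}) := by
    intro hne
    have : Nonempty ↥(X \ G) := hne.to_subtype
    have : PolishSpace (ℕ → Bool) := cantor_polish
    have : PolishSpace ↥(X \ G) := gdelta_polish _ (hX.inter hGo.isClosed_compl.isGδ)
    obtain ⟨e⟩ := irrational_baire
    suffices h : Nonempty (↥(X \ G) ≃ₜ (ℕ → ℕ)) from h.map fun e' => e'.trans e.symm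
    apply baire_of_nlc
    · intro x U hU
      obtain ⟨O, hO, hOU⟩ := mem_nhds_subtype _ _ _ |>.1 hU
      obtain ⟨O', hO', hO'o, hxO'⟩ := mem_nhds_iff.1 hO
      obtain ⟨V, hV, hxV, hVO⟩ := compact_exists_isClopen_in_isOpen hO'o hxO'
      exact ⟨Subtype.val ⁻¹' V, hV.preimage continuous_subtype_val, hxV,
        fun y hy => hOU (hO' (hVO hy))⟩
    · rintro C hC ⟨x, hx⟩ hcomp
      obtain ⟨O, hO, rfl⟩ := isOpen_induced_iff.1 hC.2
      obtain ⟨W, hW, hxW, hWO⟩ := compact_exists_isClopen_in_isOpen hO hx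
      have hc := (hcomp.image continuous_subtype_val).inter_right hW.1
      have heq : X ∩ W = ⋃ b : Bool, cond b ((X ∩ G) ∩ W)
          ((Subtype.val '' (Subtype.val ⁻¹' O : Set ↥(X \ G))) ∩ W) := by
        rw [← union_eq_iUnion]
        ext y
        constructor
        · rintro ⟨h1, h2⟩
          by_cases h : y ∈ G
          · exact Or.inl ⟨⟨h1, h⟩, h2⟩
          · exact Or.inr ⟨⟨⟨y, h1, h⟩, hWO h2, rfl⟩, h2⟩
        · rintro (h | ⟨⟨z, -, rfl⟩, h⟩)
          · exact ⟨h.1.1, h.2⟩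
          · exact ⟨z.2.1, h⟩
      apply x.2.2
      refine ⟨W, ⟨hW, ?_⟩, hxW⟩
      rw [heq]
      refine isSigmaCompact_iUnion _ fun b => ?_
      cases b
      · exact hc.isSigmaCompact
      · exact sigma_inter _ _ hXG hW.1
  refine ⟨S ∪ {Q | Q = X \ G ∧ (X \ G).Nonempty}, ?_, ?_, ?_, ?_, ?_, ?_⟩
  · exact hS.union ((countable_singleton (X \ G)).mono fun Q hQ => hQ.1)
  · rintro A (hA | ⟨rfl, -⟩)
    · exact (hSub A hA).trans inter_subset_left
    · exact diff_subset
  · rintro A (hA | ⟨rfl, -⟩) B (hB | ⟨rfl, -⟩) hAB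
    · exact hSp hA hB hAB
    · exact disjoint_sdiff_right.mono_left ((hSub A hA).trans inter_subset_right)
    · exact disjoint_sdiff_left.mono_right ((hSub B hB).trans inter_subset_right)
    · exact absurd rfl hAB
  · rw [sUnion_union, hSU]
    ext x
    constructor
    · rintro (h | ⟨_, ⟨rfl, -⟩, h⟩)
      · exact h.1
      · exact h.1
    · intro h
      by_cases hx : x ∈ G
      · exact Or.inl ⟨h, hx⟩
      · exact Or.inr ⟨_, ⟨rfl, x, h, hx⟩, h, hx⟩
  · rintro A (hA | ⟨rfl, -⟩)
    · exact (hSc A hA).1.isClosed.preimage continuous_subtype_val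
    · have : (Subtype.val ⁻¹' (X \ G) : Set ↥X) = Subtype.val ⁻¹' Gᶜ := by
        ext y; simp
      rw [this]
      exact hGo.isClosed_compl.preimage continuous_subtype_val
  · rintro A (hA | ⟨rfl, hne⟩)
    · rcases (hSc A hA).2 with h | h
      · exact Or.inl h
      · exact Or.inr (Or.inl h)
    · exact Or.inr (Or.inr (hY hne))
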